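/- arXiv:1605.01172 — 3 statements merged into one kernel-verified Lean document; each statement's English description precedes it below -/
import Mathlib

section
/- Let ω = e^{iπ/3} ∈ ℂ and let z ∈ ℂ be arbitrary. Define p : ℕ → ℂ by p₀ = 0, p₁ = 1, and for i ≥ 1: p_{2i} = p_i + (1/2)(p_i − p_{⌊i/2⌋})·ω^{−1}·z and p_{2i+1} = p_i + (1/2)(p_i − p_{⌊i/2⌋})·ω·z. For i ≥ 1 write i in binary as i = 2^h + ∑_{j=0}^{h−1} b_j·2^j with h = ⌊log₂ i⌋ and b_j ∈ {0,1}, and for 0 ≤ j ≤ h let a_j(i) be the number of 1s minus the number of 0s among b_{h−1}, b_{h−2}, …, b_{h−j} (so a_0(i) = 0). Then for every i ≥ 1, p_i = ∑_{j=0}^{h} ω^{a_j(i)}·(z/2)^j. -/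
open Real Finset

/-- `ω = e^{iπ/3}`. -/
noncomputable def ωc : ℂ := Complex.exp (Real.pi * Complex.I / 3)

/-- `a_j(i)`: the number of `1`s minus the number of `0`s among the binary digits
`b_{h-1}, b_{h-2}, …, b_{h-j}` of `i = 2^h + ∑_{j<h} b_j 2^j`, where `h = ⌊log₂ i⌋`
(so `a_0(i) = 0`). -/
def aCoef (i j : ℕ) : ℤ :=
  ∑ m ∈ Finset.Icc 1 j, (if Nat.testBit i (Nat.log 2 i - m) then 1 else -1)

theorem log_two_eq_log_half_add_one {n : ℕ} (hn : 2 ≤ n) :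
    Nat.log 2 n = Nat.log 2 (n / 2) + 1 :=
  Nat.log_of_one_lt_of_le one_lt_two hn

/-- Dropping the last binary digit does not change the leading digit counts. -/
theorem aCoef_half {n j : ℕ} (hn : 2 ≤ n) (hj : j ≤ Nat.log 2 (n / 2)) :
    aCoef n j = aCoef (n / 2) j := by
  refine Finset.sum_congr rfl fun m hm => ?_
  have hm' := Finset.mem_Icc.mp hm
  rw [log_two_eq_log_half_add_one hn,
    show Nat.log 2 (n / 2) + 1 - m = Nat.log 2 (n / 2) - m + 1 by omega, Nat.testBit_add_one]

theorem aCoef_log {n : ℕ} (hn : 2 ≤ n) :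
    aCoef n (Nat.log 2 n) =
      aCoef (n / 2) (Nat.log 2 (n / 2)) + if n.testBit 0 then 1 else -1 := by
  rw [← aCoef_half hn le_rfl]
  simp only [aCoef, log_two_eq_log_half_add_one hn,
    Finset.sum_Icc_succ_top (Nat.le_add_left 1 _), Nat.sub_self]

theorem ωc_ne_zero : ωc ≠ 0 := Complex.exp_ne_zero _

/-- The edge from the parent of `i` to `i` is the last term of the sum for `p i`. -/
theorem binary_tree_edge_formula (z : ℂ) (p : ℕ → ℂ)
    (h0 : p 0 = 0) (h1 : p 1 = 1)
    (heven : ∀ i : ℕ, 1 ≤ i → p (2 * i) = p i + (1 / 2) * (p i - p (i / 2)) * ωc⁻¹ * z)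
    (hodd : ∀ i : ℕ, 1 ≤ i → p (2 * i + 1) = p i + (1 / 2) * (p i - p (i / 2)) * ωc * z)
    (i : ℕ) (hi : 1 ≤ i) :
    p i - p (i / 2) = ωc ^ aCoef i (Nat.log 2 i) * (z / 2) ^ Nat.log 2 i := by
  induction i using Nat.strong_induction_on with
  | _ i ih =>
    rcases hi.eq_or_lt with rfl | hi2
    · simp [h0, h1, aCoef]
    have ih' := ih (i / 2) (by omega) (by omega)
    rw [aCoef_log hi2, log_two_eq_log_half_add_one hi2, zpow_add₀ ωc_ne_zero, pow_succ]
    rcases Nat.mod_two_eq_zero_or_one i with h | h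
    · have hp := heven (i / 2) (by omega)
      rw [show 2 * (i / 2) = i by omega, ih'] at hp
      rw [hp]
      simp only [Nat.testBit_zero, h, zero_ne_one, decide_false, Bool.false_eq_true, if_false,
        zpow_neg_one]
      ring
    · have hp := hodd (i / 2) (by omega)
      rw [show 2 * (i / 2) + 1 = i by omega, ih'] at hp
      rw [hp]
      simp only [Nat.testBit_zero, h, decide_true, if_true, zpow_one]
      ring

/-- If `p : ℕ → ℂ` satisfies `p 0 = 0`, `p 1 = 1`,
`p (2i) = p i + (1/2)(p i - p ⌊i/2⌋)·ω⁻¹·z` and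
`p (2i+1) = p i + (1/2)(p i - p ⌊i/2⌋)·ω·z` for all `i ≥ 1`, then for every `i ≥ 1`,
`p i = ∑_{j=0}^{⌊log₂ i⌋} ω^{a_j(i)} (z/2)^j`. -/
theorem binary_tree_vertex_formula (z : ℂ) (p : ℕ → ℂ)
    (h0 : p 0 = 0) (h1 : p 1 = 1)
    (heven : ∀ i : ℕ, 1 ≤ i → p (2 * i) = p i + (1 / 2) * (p i - p (i / 2)) * ωc⁻¹ * z)
    (hodd : ∀ i : ℕ, 1 ≤ i → p (2 * i + 1) = p i + (1 / 2) * (p i - p (i / 2)) * ωc * z) :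
    ∀ i : ℕ, 1 ≤ i →
      p i = ∑ j ∈ Finset.range (Nat.log 2 i + 1), ωc ^ (aCoef i j) * (z / 2) ^ j := by
  intro i hi
  induction i using Nat.strong_induction_on with
  | _ i ih =>
    have hedge := binary_tree_edge_formula z p h0 h1 heven hodd i hi
    rw [Finset.sum_range_succ, ← hedge]
    rcases hi.eq_or_lt with rfl | hi2
    · simp [h0]
    rw [log_two_eq_log_half_add_one hi2, Finset.sum_congr rfl fun j hj => by
      rw [aCoef_half hi2 (Nat.lt_succ_iff.mp (Finset.mem_range.mp hj))],
      ← ih (i / 2) (by omega) (by omega)]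
    ring
end

section
/- Let ω = e^{iπ/3} ∈ ℂ, let z ∈ ℂ, let k ≥ 1 be an integer, and let p : ℕ → ℂ be defined by p₀ = 0, p₁ = 1, p_{2i} = p_i + (1/2)(p_i − p_{⌊i/2⌋})·ω^{−1}·z, p_{2i+1} = p_i + (1/2)(p_i − p_{⌊i/2⌋})·ω·z for i ≥ 1. Define q_i for 1 ≤ i ≤ 2^{k+1}−1 by q_i = p_i for 2^k ≤ i ≤ 2^{k+1}−1, and q_i = p_i + 2(q_{2i} − p_i) + 2(q_{2i+1} − p_i) for 1 ≤ i ≤ 2^k − 1. Then for every i with 1 ≤ i ≤ 2^k − 1, writing h = h(i) = ⌊log₂ i⌋, one has q_i = p_i + ω^{a_h(i)}·(z/2)^h·(z + z² + … + z^{k−h}), where a_h(i) is the number of 1s minus the number of 0s among the binary digits b_{h−1}, …, b_0 of i = 2^h + ∑_{j=0}^{h−1} b_j·2^j. -/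
open Real Finset

theorem ωc_add_inv : ωc + ωc⁻¹ = 1 := by
  have h : ωc + ωc⁻¹ = 2 * Complex.cos ((Real.pi / 3 : ℝ) : ℂ) := by
    rw [Complex.two_cos, ωc, ← Complex.exp_neg]
    push_cast
    ring_nf
  rw [h, ← Complex.ofReal_cos, Real.cos_pi_div_three]
  norm_num

theorem log_two_mul_add {i b : ℕ} (hi : 1 ≤ i) (hb : b < 2) :
    Nat.log 2 (2 * i + b) = Nat.log 2 i + 1 := by
  rw [Nat.log_of_one_lt_of_le one_lt_two (by omega)]
  congr 2
  omega

theorem aCoef_two_mul_add {i b : ℕ} (hi : 1 ≤ i) (hb : b < 2) :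
    aCoef (2 * i + b) (Nat.log 2 (2 * i + b)) =
      aCoef i (Nat.log 2 i) + (if b = 1 then 1 else -1) := by
  unfold aCoef
  rw [log_two_mul_add hi hb, Finset.sum_Icc_succ_top (by omega)]
  congr 1
  · refine Finset.sum_congr rfl fun m hm => ?_
    have hm' := (Finset.mem_Icc.mp hm).2
    rw [show Nat.log 2 i + 1 - m = (Nat.log 2 i - m) + 1 by omega, Nat.testBit_succ,
      show (2 * i + b) / 2 = i by omega]
  · rw [Nat.sub_self, Nat.testBit_zero]
    interval_cases b <;> simp [Nat.add_mod]

/-- The edge vector from the parent of vertex `i` to vertex `i`. -/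
noncomputable def edgeVec (z : ℂ) (i : ℕ) : ℂ :=
  ωc ^ (aCoef i (Nat.log 2 i)) * (z / 2) ^ (Nat.log 2 i)

theorem edgeVec_one (z : ℂ) : edgeVec z 1 = 1 := by
  simp [edgeVec, aCoef]

theorem edgeVec_two_mul (z : ℂ) {i : ℕ} (hi : 1 ≤ i) :
    edgeVec z (2 * i) = 1 / 2 * edgeVec z i * ωc⁻¹ * z := by
  have ha := aCoef_two_mul_add hi (b := 0) (by omega)
  have hl := log_two_mul_add hi (b := 0) (by omega)
  simp only [add_zero, zero_ne_one, if_false] at ha hl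
  rw [edgeVec, ha, hl, zpow_add₀ ωc_ne_zero, zpow_neg_one, edgeVec, pow_succ]
  ring

theorem edgeVec_two_mul_add_one (z : ℂ) {i : ℕ} (hi : 1 ≤ i) :
    edgeVec z (2 * i + 1) = 1 / 2 * edgeVec z i * ωc * z := by
  rw [edgeVec, aCoef_two_mul_add hi (by omega), log_two_mul_add hi (by omega), if_pos rfl,
    zpow_add₀ ωc_ne_zero, zpow_one, edgeVec, pow_succ]
  ring

theorem sub_parent_eq_edgeVec {z : ℂ} {p : ℕ → ℂ} (h0 : p 0 = 0) (h1 : p 1 = 1)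
    (heven : ∀ i : ℕ, 1 ≤ i → p (2 * i) = p i + (1 / 2) * (p i - p (i / 2)) * ωc⁻¹ * z)
    (hodd : ∀ i : ℕ, 1 ≤ i → p (2 * i + 1) = p i + (1 / 2) * (p i - p (i / 2)) * ωc * z)
    (i : ℕ) (hi : 1 ≤ i) : p i - p (i / 2) = edgeVec z i := by
  induction i using Nat.strong_induction_on with
  | _ i ih =>
    obtain rfl | hi' := hi.eq_or_lt
    · simp [h0, h1, edgeVec_one]
    obtain ⟨m, rfl | rfl⟩ := Nat.even_or_odd' i
    · have hm : 1 ≤ m := by omega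
      rw [show 2 * m / 2 = m by omega, heven m hm, ih m (by omega) hm, edgeVec_two_mul z hm]
      ring
    · have hm : 1 ≤ m := by omega
      rw [show (2 * m + 1) / 2 = m by omega, hodd m hm, ih m (by omega) hm,
        edgeVec_two_mul_add_one z hm]
      ring

theorem sum_Icc_one_succ_pow (z : ℂ) (n : ℕ) :
    ∑ j ∈ Finset.Icc 1 (n + 1), z ^ j = z * (1 + ∑ j ∈ Finset.Icc 1 n, z ^ j) := by
  induction n with
  | zero => simp
  | succ n ih =>
    have h := Finset.sum_Icc_succ_top (show 1 ≤ n + 1 by omega) fun j => z ^ j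
    rw [Finset.sum_Icc_succ_top (show 1 ≤ n + 1 + 1 by omega)]
    linear_combination ih - z * h

/-- Quasi-terminal formula for Melzak's algorithm on the binary-tree construction:
if `p` satisfies the vertex recurrence and `q` satisfies `q i = p i` for
`2^k ≤ i ≤ 2^(k+1) - 1` and `q i = p i + 2(q (2i) - p i) + 2(q (2i+1) - p i)` for
`1 ≤ i ≤ 2^k - 1`, then for `1 ≤ i ≤ 2^k - 1` with `h = ⌊log₂ i⌋`,
`q i = p i + ω^{a_h(i)}·(z/2)^h·(z + z² + … + z^{k-h})`. -/
theorem quasi_terminal_formula (z : ℂ) (k : ℕ) (hk : 1 ≤ k) (p q : ℕ → ℂ)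
    (h0 : p 0 = 0) (h1 : p 1 = 1)
    (heven : ∀ i : ℕ, 1 ≤ i → p (2 * i) = p i + (1 / 2) * (p i - p (i / 2)) * ωc⁻¹ * z)
    (hodd : ∀ i : ℕ, 1 ≤ i → p (2 * i + 1) = p i + (1 / 2) * (p i - p (i / 2)) * ωc * z)
    (hqTop : ∀ i : ℕ, 2 ^ k ≤ i → i ≤ 2 ^ (k + 1) - 1 → q i = p i)
    (hqRec : ∀ i : ℕ, 1 ≤ i → i ≤ 2 ^ k - 1 →
      q i = p i + 2 * (q (2 * i) - p i) + 2 * (q (2 * i + 1) - p i)) :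
    ∀ i : ℕ, 1 ≤ i → i ≤ 2 ^ k - 1 →
      q i = p i + ωc ^ (aCoef i (Nat.log 2 i)) * (z / 2) ^ (Nat.log 2 i) *
        ∑ j ∈ Finset.Icc 1 (k - Nat.log 2 i), z ^ j := by
  have hp := sub_parent_eq_edgeVec h0 h1 heven hodd
  have key : ∀ n i : ℕ, 1 ≤ i → Nat.log 2 i + n = k →
      q i = p i + edgeVec z i * ∑ j ∈ Finset.Icc 1 n, z ^ j := by
    intro n
    induction n with
    | zero =>
      intro i hi hn
      obtain ⟨hlo, hhi⟩ := (Nat.log_eq_iff (Or.inr ⟨one_lt_two, by omega⟩)).mp hn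
      rw [hqTop i hlo (by omega)]
      simp
    | succ n ih =>
      intro i hi hn
      have hik : i < 2 ^ k := Nat.lt_pow_of_log_lt one_lt_two (by omega)
      have hl0 := log_two_mul_add hi (b := 0) (by omega)
      have hl1 := log_two_mul_add hi (b := 1) (by omega)
      rw [add_zero] at hl0
      rw [hqRec i hi (by omega), ih (2 * i) (by omega) (by omega),
        ih (2 * i + 1) (by omega) (by omega), heven i hi, hodd i hi, hp i hi,
        edgeVec_two_mul z hi, edgeVec_two_mul_add_one z hi, sum_Icc_one_succ_pow]
      linear_combination edgeVec z i * z * (1 + ∑ j ∈ Finset.Icc 1 n, z ^ j) * ωc_add_inv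
  intro i hi hik
  have hpos : 0 < 2 ^ k := by positivity
  have hlog : Nat.log 2 i < k := Nat.log_lt_of_lt_pow (by omega) (by omega)
  exact key _ i hi (by omega)
end

section
/- For every integer k ≥ 1 and every real ε with 0 < ε ≤ 1/k², one has (k+1)·sin(ε/2) ≥ (1 + (k² + 2k)·ε²/24)·sin((k+1)·ε/2). Equivalently, since sin((k+1)ε/2) > 0 in this range, (k+1)·sin(ε/2)/sin((k+1)·ε/2) ≥ 1 + (k² + 2k)·ε²/24. -/
open Real

/-- A function vanishing at `0` with nonnegative derivative on `[0, ∞)` is nonnegative there. -/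
theorem nonneg_of_hasDerivAt_of_zero {f f' : ℝ → ℝ} (hf : ∀ x, HasDerivAt f (f' x) x)
    (h0 : f 0 = 0) (hf' : ∀ x, 0 ≤ x → 0 ≤ f' x) {x : ℝ} (hx : 0 ≤ x) : 0 ≤ f x := by
  have hmono : MonotoneOn f (Set.Ici 0) := by
    refine monotoneOn_of_deriv_nonneg (convex_Ici 0)
      (fun y _ => (hf y).continuousAt.continuousWithinAt)
      (fun y _ => (hf y).differentiableAt.differentiableWithinAt) fun y hy => ?_
    rw [interior_Ici] at hy
    rw [(hf y).deriv]
    exact hf' y (le_of_lt hy)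
  simpa [h0] using hmono (Set.mem_Ici.2 le_rfl) (Set.mem_Ici.2 hx) hx

theorem sub_cube_div_six_le_sin {x : ℝ} (hx : 0 ≤ x) : x - x ^ 3 / 6 ≤ sin x := by
  have h := nonneg_of_hasDerivAt_of_zero (f := fun y => sin y - (y - y ^ 3 / 6))
    (f' := fun y => cos y - (1 - y ^ 2 / 2))
    (fun y => by
      convert! (hasDerivAt_sin y).sub
        ((hasDerivAt_id y).sub ((hasDerivAt_pow 3 y).div_const 6)) using 1
      norm_num; ring)
    (by simp) (fun y _ => sub_nonneg.2 one_sub_sq_div_two_le_cos) hx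
  exact sub_nonneg.1 h

theorem cos_le_quartic {x : ℝ} (hx : 0 ≤ x) : cos x ≤ 1 - x ^ 2 / 2 + x ^ 4 / 24 := by
  have h := nonneg_of_hasDerivAt_of_zero (f := fun y => 1 - y ^ 2 / 2 + y ^ 4 / 24 - cos y)
    (f' := fun y => sin y - (y - y ^ 3 / 6))
    (fun y => by
      convert! ((((hasDerivAt_pow 2 y).div_const 2).const_sub 1).add
        ((hasDerivAt_pow 4 y).div_const 24)).sub (hasDerivAt_cos y) using 1
      norm_num; ring)
    (by simp) (fun y hy => sub_nonneg.2 (sub_cube_div_six_le_sin hy)) hx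
  exact sub_nonneg.1 h

theorem sin_le_quintic {x : ℝ} (hx : 0 ≤ x) : sin x ≤ x - x ^ 3 / 6 + x ^ 5 / 120 := by
  have h := nonneg_of_hasDerivAt_of_zero (f := fun y => y - y ^ 3 / 6 + y ^ 5 / 120 - sin y)
    (f' := fun y => 1 - y ^ 2 / 2 + y ^ 4 / 24 - cos y)
    (fun y => by
      convert! (((hasDerivAt_id y).sub ((hasDerivAt_pow 3 y).div_const 6)).add
        ((hasDerivAt_pow 5 y).div_const 120)).sub (hasDerivAt_sin y) using 1
      norm_num; ring)
    (by simp) (fun y hy => sub_nonneg.2 (cos_le_quartic hy)) hx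
  exact sub_nonneg.1 h

theorem one_add_mul_sin_mul_le_mul_sin {n x : ℝ} (hn : 2 ≤ n) (hx : 0 ≤ x) (hnx : n * x ≤ 1) :
    (1 + (n ^ 2 - 1) * x ^ 2 / 6) * sin (n * x) ≤ n * sin x := by
  have hy : 0 ≤ n * x := by positivity
  have hn2 : 4 ≤ n ^ 2 := by nlinarith
  have hy2 : (n * x) ^ 2 ≤ 1 := pow_le_one₀ hy hnx
  have hc : 0 ≤ n ^ 2 * (n ^ 2 - 1) / 36 - n ^ 4 / 120
      - (n ^ 2 - 1) * n ^ 2 * (n * x) ^ 2 / 720 := by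
    have h : 0 ≤ (n ^ 2 - 1) * n ^ 2 * (1 - (n * x) ^ 2) :=
      mul_nonneg (mul_nonneg (by linarith) (by positivity)) (by linarith)
    nlinarith [mul_nonneg (sq_nonneg n) (sub_nonneg.2 hn2)]
  have hpoly : (1 + (n ^ 2 - 1) * x ^ 2 / 6) * (n * x - (n * x) ^ 3 / 6 + (n * x) ^ 5 / 120)
      ≤ n * (x - x ^ 3 / 6) := by
    have h : 0 ≤ n * x ^ 5 * (n ^ 2 * (n ^ 2 - 1) / 36 - n ^ 4 / 120
        - (n ^ 2 - 1) * n ^ 2 * (n * x) ^ 2 / 720) := mul_nonneg (by positivity) hc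
    linear_combination h
  have hfac : 0 ≤ 1 + (n ^ 2 - 1) * x ^ 2 / 6 := by
    have := mul_nonneg (by linarith : 0 ≤ n ^ 2 - 1) (sq_nonneg x)
    linarith
  calc _ ≤ _ := mul_le_mul_of_nonneg_left (sin_le_quintic hy) hfac
    _ ≤ _ := hpoly
    _ ≤ _ := mul_le_mul_of_nonneg_left (sub_cube_div_six_le_sin hx) (by linarith)

/-- For every integer `k ≥ 1` and `0 < ε ≤ 1/k²`,
`(k+1)·sin(ε/2) ≥ (1 + (k² + 2k)·ε²/24)·sin((k+1)·ε/2)`; equivalently,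
`(k+1)·sin(ε/2)/sin((k+1)·ε/2) ≥ 1 + (k² + 2k)·ε²/24`. -/
theorem binary_tree_ratio_inequality (k : ℕ) (hk : 1 ≤ k) (ε : ℝ) (hε0 : 0 < ε)
    (hε : ε ≤ 1 / (k : ℝ) ^ 2) :
    ((k : ℝ) + 1) * Real.sin (ε / 2) ≥
      (1 + ((k : ℝ) ^ 2 + 2 * k) * ε ^ 2 / 24) * Real.sin (((k : ℝ) + 1) * ε / 2) ∧
    ((k : ℝ) + 1) * Real.sin (ε / 2) / Real.sin (((k : ℝ) + 1) * ε / 2) ≥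
      1 + ((k : ℝ) ^ 2 + 2 * k) * ε ^ 2 / 24 := by
  have hk1 : (1 : ℝ) ≤ k := by exact_mod_cast hk
  have hεk : ε * (k : ℝ) ^ 2 ≤ 1 := (le_div_iff₀ (by positivity)).1 hε
  have hnx : ((k : ℝ) + 1) * (ε / 2) ≤ 1 := by
    nlinarith [mul_nonneg hε0.le (by nlinarith : 0 ≤ 2 * (k : ℝ) ^ 2 - (k + 1))]
  have hmain := one_add_mul_sin_mul_le_mul_sin (by linarith : (2 : ℝ) ≤ k + 1)
    (by positivity : 0 ≤ ε / 2) hnx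
  rw [← mul_div_assoc] at hmain hnx
  have hcoef : (1 + (((k : ℝ) + 1) ^ 2 - 1) * (ε / 2) ^ 2 / 6)
      = 1 + ((k : ℝ) ^ 2 + 2 * k) * ε ^ 2 / 24 := by ring
  rw [hcoef] at hmain
  have hsin : 0 < sin (((k : ℝ) + 1) * ε / 2) :=
    sin_pos_of_pos_of_lt_pi (by positivity) (by linarith [pi_gt_three])
  exact ⟨hmain, (le_div_iff₀ hsin).2 hmain⟩
end
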